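/- arXiv:2204.02168 — 8 statements merged into one kernel-verified Lean document; each statement's English description precedes it below -/
import Mathlib

section
/- Let r be a rational number such that 2r is not an integer. Then tan²(rπ) is either irrational or equal to one of 0, 1, 3, 1/3. -/
open Real

theorem cos_two_mul_eq_of_tan_sq {θ : ℝ} (hθ : cos θ ≠ 0) :
    cos (2 * θ) = (1 - tan θ ^ 2) / (1 + tan θ ^ 2) := by
  have hsum := sin_sq_add_cos_sq θ
  rw [tan_eq_sin_div_cos, eq_div_iff (by positivity), cos_two_mul]
  field_simp
  linear_combination (2 * cos θ ^ 2) * hsum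

theorem tan_sq_rat_pi_irrational (r : ℚ) (h : ∀ k : ℤ, 2 * r ≠ (k : ℚ)) :
    Irrational ((Real.tan (r * π)) ^ 2) ∨
      (Real.tan (r * π)) ^ 2 = 0 ∨ (Real.tan (r * π)) ^ 2 = 1 ∨
      (Real.tan (r * π)) ^ 2 = 3 ∨ (Real.tan (r * π)) ^ 2 = 1 / 3 := by
  by_cases hcos : cos (r * π) = 0
  · simp [tan_eq_sin_div_cos, hcos]
  refine or_iff_not_imp_left.2 fun hrat ↦ ?_
  obtain ⟨q, hq⟩ := not_not.1 hrat
  have hcos_two := cos_two_mul_eq_of_tan_sq hcos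
  have hniven := niven (θ := 2 * (r * π)) ⟨2 * r, by push_cast; ring⟩
    ⟨(1 - q) / (1 + q), by rw [hcos_two, ← hq]; push_cast; rfl⟩
  have hpos : 0 < 1 + tan (r * π) ^ 2 := by positivity
  rw [eq_div_iff hpos.ne'] at hcos_two
  simp only [Set.mem_insert_iff, Set.mem_singleton_iff] at hniven
  rcases hniven with hc | hc | hc | hc | hc <;> rw [hc] at hcos_two
  · linarith
  · exact .inr (.inr (.inl (by linarith)))
  · exact .inr (.inl (by linarith))
  · exact .inr (.inr (.inr (by linarith)))
  · exact .inl (by linarith)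
end

section
/- Let r be a rational number such that 2r is not an integer. Then tan(rπ) is either irrational or equal to one of -1, 0, 1. -/
open Real

/-- If `tan θ` is rational at a rational multiple `θ` of `π`, then it is `-1`, `0` or `1`. -/
theorem tan_eq_of_rat_mul_pi_of_rat {θ : ℝ} (hθ : ∃ r : ℚ, θ = r * π)
    (htan : ∃ q : ℚ, tan θ = q) : tan θ = -1 ∨ tan θ = 0 ∨ tan θ = 1 := by
  by_cases hcos : cos θ = 0
  · simp [tan_eq_sin_div_cos, hcos]
  obtain ⟨r, rfl⟩ := hθ
  obtain ⟨q, hq⟩ := htan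
  have hangle : ∃ s : ℚ, 2 * (r * π) = s * π := ⟨2 * r, by push_cast; ring⟩
  have hcos_sq : cos (r * π) ^ 2 = (1 + (q : ℝ) ^ 2)⁻¹ := by
    rw [← hq, inv_one_add_tan_sq hcos]
  have hcos_two : cos (2 * (r * π)) = 2 * (1 + (q : ℝ) ^ 2)⁻¹ - 1 := by
    rw [cos_two_mul, hcos_sq]
  have hsin_two : sin (2 * (r * π)) = 2 * q * (1 + (q : ℝ) ^ 2)⁻¹ := by
    rw [sin_two_mul, ← hcos_sq, ← hq, ← tan_mul_cos hcos]
    ring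
  have hsin_mem := niven_sin hangle ⟨2 * q * (1 + q ^ 2)⁻¹, by rw [hsin_two]; push_cast; rfl⟩
  have hcos_mem := niven hangle ⟨2 * (1 + q ^ 2)⁻¹ - 1, by rw [hcos_two]; push_cast; rfl⟩
  have hpyth := sin_sq_add_cos_sq (2 * (r * π))
  have hinv : (1 + (q : ℝ) ^ 2)⁻¹ * (1 + (q : ℝ) ^ 2) = 1 := inv_mul_cancel₀ (by positivity)
  simp only [Set.mem_insert_iff, Set.mem_singleton_iff] at hsin_mem hcos_mem
  rw [hq]
  rcases hcos_mem with hc | hc | hc | hc | hc <;>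
    rcases hsin_mem with hs | hs | hs | hs | hs <;> grind

theorem tan_rat_pi_irrational (r : ℚ) (h : ∀ k : ℤ, 2 * r ≠ (k : ℚ)) :
    Irrational (Real.tan (r * π)) ∨
      Real.tan (r * π) = -1 ∨ Real.tan (r * π) = 0 ∨ Real.tan (r * π) = 1 := by
  rw [or_iff_not_imp_left]
  intro hrat
  exact tan_eq_of_rat_mul_pi_of_rat ⟨r, rfl⟩ (exists_rat_of_not_irrational hrat)
end

section
/- Let r be a rational number. Then cos²(rπ) is either irrational or equal to one of 0, 1, 1/2, 1/4, 3/4. -/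
open Real

theorem cos_sq_rat_pi_irrational (r : ℚ) :
    Irrational ((Real.cos (r * π)) ^ 2) ∨
      (Real.cos (r * π)) ^ 2 = 0 ∨ (Real.cos (r * π)) ^ 2 = 1 ∨
      (Real.cos (r * π)) ^ 2 = 1 / 2 ∨ (Real.cos (r * π)) ^ 2 = 1 / 4 ∨
      (Real.cos (r * π)) ^ 2 = 3 / 4 := by
  refine or_iff_not_imp_left.mpr fun h => ?_
  obtain ⟨q, hq⟩ := exists_rat_of_not_irrational h
  have hdouble := cos_two_mul (r * π)
  have hniven := niven (θ := 2 * (r * π)) ⟨2 * r, by push_cast; ring⟩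
    ⟨2 * q - 1, by push_cast; rw [hdouble, hq]⟩
  simp only [Set.mem_insert_iff, Set.mem_singleton_iff] at hniven
  grind
end

section
/- Let r be a rational number. Then cos(rπ) is either irrational or equal to one of 0, 1, -1, 1/2, -1/2. -/
open Real

theorem cos_rat_pi_irrational (r : ℚ) :
    Irrational (Real.cos (r * π)) ∨
      Real.cos (r * π) = 0 ∨ Real.cos (r * π) = 1 ∨ Real.cos (r * π) = -1 ∨
      Real.cos (r * π) = 1 / 2 ∨ Real.cos (r * π) = -(1 / 2) := by
  refine or_iff_not_imp_left.mpr fun hirr => ?_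
  have hmem := niven ⟨r, rfl⟩ (exists_rat_of_not_irrational hirr)
  simp only [Set.mem_insert_iff, Set.mem_singleton_iff] at hmem
  grind
end

section
/- Let r be a real number such that 2r is not an integer and 4r is not an integer (so that tan(rπ) and tan(2rπ) are defined and 1 - tan²(rπ) ≠ 0 is not assumed). If tan²(rπ) is a rational number different from 0 and from 1, then tan²(2rπ) is a rational number different from 0 and from 1. -/
open Real

theorem tan_sq_two_mul (x : ℝ) :
    Real.tan (2 * x) ^ 2 = 4 * Real.tan x ^ 2 / (1 - Real.tan x ^ 2) ^ 2 := by
  rw [Real.tan_two_mul, div_pow]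
  ring

theorem rat_sq_ne_two (q : ℚ) : (q : ℝ) ^ 2 ≠ 2 := by
  intro h
  apply irrational_sqrt_two
  exact ⟨|q|, by rw [← h, Real.sqrt_sq_eq_abs, Rat.cast_abs]⟩

theorem tan_sq_double_rational (r : ℝ)
    (h2 : ∀ k : ℤ, 2 * r ≠ (k : ℝ)) (h4 : ∀ k : ℤ, 4 * r ≠ (k : ℝ))
    (hrat : ¬ Irrational ((Real.tan (r * π)) ^ 2))
    (h0 : (Real.tan (r * π)) ^ 2 ≠ 0) (h1 : (Real.tan (r * π)) ^ 2 ≠ 1) :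
    ¬ Irrational ((Real.tan (2 * r * π)) ^ 2) ∧
      (Real.tan (2 * r * π)) ^ 2 ≠ 0 ∧ (Real.tan (2 * r * π)) ^ 2 ≠ 1 := by
  obtain ⟨q, hq⟩ := not_not.mp hrat
  rw [mul_assoc, tan_sq_two_mul, ← hq]
  rw [← hq] at h0 h1
  have hden : (1 - (q : ℝ)) ^ 2 ≠ 0 := pow_ne_zero 2 (sub_ne_zero.mpr h1.symm)
  refine ⟨not_not.mpr ⟨4 * q / (1 - q) ^ 2, by push_cast; rfl⟩,
    div_ne_zero (mul_ne_zero four_ne_zero h0) hden, fun h => ?_⟩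
  rw [div_eq_one_iff_eq hden] at h
  apply rat_sq_ne_two ((q - 3) / 2)
  push_cast
  linarith
end

section
/- Let n = 2m + 1 be an odd positive integer with m ≥ 1 and d an integer with gcd(d, n) = 1. Then s = tan²(2dπ/n) is a root of the monic integer polynomial Q(X) = Σ_{j=0}^{m} (-1)^{m+j} · binom(n, 2j+1) · X^{j}. -/
open Real Polynomial Finset

theorem im_one_add_mul_I_pow_odd (m : ℕ) (t : ℝ) :
    ((1 + t * Complex.I) ^ (2 * m + 1)).im =
      ∑ j ∈ Finset.range (m + 1),
        (-1 : ℝ) ^ j * ((2 * m + 1).choose (2 * j + 1) : ℝ) * t ^ (2 * j + 1) := by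
  have pair (f : ℕ → ℂ) (k : ℕ) : ∑ i ∈ Finset.range (2 * k), f i =
      ∑ j ∈ Finset.range k, (f (2 * j) + f (2 * j + 1)) := by
    induction k with
    | zero => simp
    | succ k ih =>
      rw [Finset.sum_range_succ, ← ih, mul_add, mul_one, Finset.sum_range_succ,
        Finset.sum_range_succ, add_assoc]
  rw [add_comm (1 : ℂ), add_pow, show 2 * m + 1 + 1 = 2 * (m + 1) by ring, pair, Complex.im_sum]
  refine Finset.sum_congr rfl fun j _ => ?_
  have even_term : (t * Complex.I) ^ (2 * j) = (((-1) ^ j * t ^ (2 * j) : ℝ) : ℂ) := by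
    rw [mul_pow, pow_mul Complex.I, Complex.I_sq]
    push_cast
    ring
  rw [pow_succ (t * Complex.I), even_term, one_pow, one_pow, mul_one, mul_one,
    show (((-1) ^ j * t ^ (2 * j) : ℝ) : ℂ) * ((2 * m + 1).choose (2 * j) : ℂ) +
      (((-1) ^ j * t ^ (2 * j) : ℝ) : ℂ) * (t * Complex.I) * ((2 * m + 1).choose (2 * j + 1) : ℂ) =
      (((-1) ^ j * t ^ (2 * j) * ((2 * m + 1).choose (2 * j) : ℝ) : ℝ) : ℂ) +
      (((-1) ^ j * ((2 * m + 1).choose (2 * j + 1) : ℝ) * t ^ (2 * j + 1) : ℝ) : ℂ) * Complex.I by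
        push_cast; ring]
  rw [Complex.add_im, Complex.ofReal_im, Complex.im_ofReal_mul, Complex.I_im]
  ring

theorem im_one_add_tan_mul_I_pow_eq_zero {θ : ℝ} (hcos : Real.cos θ ≠ 0) (n : ℕ) (d : ℤ)
    (h : n * θ = d * (2 * π)) : ((1 + (Real.tan θ : ℂ) * Complex.I) ^ n).im = 0 := by
  have hc : (1 + (Real.tan θ : ℂ) * Complex.I) * (Real.cos θ : ℂ) =
      Complex.exp (θ * Complex.I) := by
    rw [Complex.exp_mul_I, ← Complex.ofReal_cos, ← Complex.ofReal_sin, add_mul, one_mul,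
      mul_right_comm, ← Complex.ofReal_mul, Real.tan_mul_cos hcos]
  have hn : (1 + (Real.tan θ : ℂ) * Complex.I) ^ n * ((Real.cos θ ^ n : ℝ) : ℂ) = 1 := by
    rw [Complex.ofReal_pow, ← mul_pow, hc, ← Complex.exp_nat_mul, ← mul_assoc,
      show (n : ℂ) * θ = d * (2 * π) by exact_mod_cast h, mul_assoc,
      Complex.exp_int_mul_two_pi_mul_I]
  have him := congrArg Complex.im hn
  rw [Complex.im_mul_ofReal, Complex.one_im] at him
  exact (mul_eq_zero.mp him).resolve_right (pow_ne_zero n hcos)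

theorem tan_sq_root_of_Q (m : ℕ) (hm : 1 ≤ m) (d : ℤ) (hd : Int.gcd d (2 * m + 1) = 1) :
    (∑ j ∈ Finset.range (m + 1),
        Polynomial.C ((-1 : ℤ) ^ (m + j) * ((2 * m + 1).choose (2 * j + 1) : ℤ)) *
          Polynomial.X ^ j : Polynomial ℤ).Monic ∧
      Polynomial.aeval ((Real.tan (2 * d * π / (2 * m + 1))) ^ 2)
        (∑ j ∈ Finset.range (m + 1),
          Polynomial.C ((-1 : ℤ) ^ (m + j) * ((2 * m + 1).choose (2 * j + 1) : ℤ)) *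
            Polynomial.X ^ j) = 0 := by
  constructor
  · refine Polynomial.monic_of_natDegree_le_of_coeff_eq_one m ?_ ?_
    · refine Polynomial.natDegree_sum_le_of_forall_le _ _ fun j hj => ?_
      exact (Polynomial.natDegree_C_mul_X_pow_le _ _).trans
        (Nat.lt_succ_iff.mp (Finset.mem_range.mp hj))
    · simp only [Polynomial.finsetSum_coeff, Polynomial.coeff_C_mul_X_pow]
      rw [Finset.sum_ite_eq, if_pos (Finset.self_mem_range_succ m), Nat.choose_self,
        Even.neg_one_pow ⟨m, rfl⟩]
      simp
  · set θ : ℝ := 2 * d * π / (2 * m + 1) with hθ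
    have hn : (2 * m + 1 : ℝ) ≠ 0 := by positivity
    have hnθ : ((2 * m + 1 : ℕ) : ℝ) * θ = d * (2 * π) := by
      rw [hθ]
      push_cast
      field_simp
    have hcos : Real.cos θ ≠ 0 := by
      rw [Real.cos_ne_zero_iff]
      intro k hk
      rw [hk] at hnθ
      push_cast at hnθ
      have h : ((2 * m + 1) * (2 * k + 1) : ℝ) = 4 * d :=
        mul_right_cancel₀ Real.pi_ne_zero (by linear_combination 2 * hnθ)
      have h' : ((2 * m + 1) * (2 * k + 1) : ℤ) = 4 * d := by exact_mod_cast h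
      have : (2 : ℤ) * (2 * d - 2 * m * k - m - k) = 1 := by linear_combination -h'
      omega
    have hsin : Real.sin θ ≠ 0 := by
      rw [Real.sin_ne_zero_iff]
      intro k hk
      rw [← hk] at hnθ
      push_cast at hnθ
      have h : ((2 * m + 1) * k : ℝ) = 2 * d :=
        mul_right_cancel₀ Real.pi_ne_zero (by linear_combination hnθ)
      have h' : ((2 * m + 1) * k : ℤ) = d * 2 := by
        rw [mul_comm d]
        exact_mod_cast h
      have hdvd : (2 * m + 1 : ℤ) ∣ 2 :=
        IsCoprime.dvd_of_dvd_mul_left (Int.isCoprime_iff_gcd_eq_one.mpr hd).symm ⟨k, h'.symm⟩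
      have := Int.le_of_dvd two_pos hdvd
      omega
    have htan : Real.tan θ ≠ 0 := by
      rw [Real.tan_eq_sin_div_cos]
      exact div_ne_zero hsin hcos
    have him := im_one_add_tan_mul_I_pow_eq_zero hcos (2 * m + 1) d hnθ
    rw [im_one_add_mul_I_pow_odd] at him
    refine (mul_eq_zero.mp (?_ : Real.tan θ * _ = 0)).resolve_left htan
    rw [map_sum, Finset.mul_sum, ← mul_zero ((-1 : ℝ) ^ m), ← him, Finset.mul_sum]
    refine Finset.sum_congr rfl fun j _ => ?_
    simp only [map_mul, map_pow, Polynomial.aeval_X, map_neg, map_one,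
      map_natCast]
    ring
end

section
/- Let n = 2m + 1 be an odd positive integer with m ≥ 1 and d an integer with gcd(d, n) = 1 and n not dividing d. If tan²(2dπ/n) is a rational number, then tan²(2dπ/n) is an odd positive integer dividing n. -/
open Real

open Polynomial in
/-- The Chebyshev-like polynomials in `-tan² θ` expressing `cos` and `sin` of odd multiples of
`θ`; the one for `sin` is monic with constant coefficient `2 * m + 1`. -/
theorem exists_polynomial_neg_tan_sq (m : ℕ) : ∃ A B : ℤ[X], A.natDegree ≤ m ∧
    B.Monic ∧ B.natDegree = m ∧ B.eval 0 = 2 * m + 1 ∧ A.eval 0 = 1 ∧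
    ∀ θ t : ℝ, sin θ = t * cos θ →
      cos ((2 * m + 1) * θ) = cos θ ^ (2 * m + 1) * aeval (-t ^ 2) A ∧
      sin ((2 * m + 1) * θ) = cos θ ^ (2 * m + 1) * t * aeval (-t ^ 2) B := by
  induction m with
  | zero => exact ⟨1, 1, by simp, monic_one, by simp, by simp, by simp, fun θ t h => by
      simp [h, mul_comm]⟩
  | succ m ih =>
    obtain ⟨A, B, hA, hB, hBd, hB0, hA0, hAB⟩ := ih
    have hdeg : (B + 2 * A).degree < (X * B).degree := by
      rw [degree_mul, degree_X, degree_eq_natDegree hB.ne_zero, hBd]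
      have : (B + 2 * A).natDegree ≤ m := by compute_degree!; omega
      refine (degree_le_of_natDegree_le this).trans_lt ?_
      norm_cast
      omega
    have hmonic : (X * B).Monic := monic_X.mul hB
    refine ⟨A + X * A + 2 * X * B, X * B + (B + 2 * A), ?_, hmonic.add_of_left hdeg, ?_, ?_, ?_,
      fun θ t h => ?_⟩
    · compute_degree!
      omega
    · rw [natDegree_add_eq_left_of_degree_lt hdeg, monic_X.natDegree_mul hB, natDegree_X, hBd,
        add_comm]
    · simp [hB0, hA0]
      ring
    · simp [hA0]
    · obtain ⟨hc, hs⟩ := hAB θ t h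
      have h2 : cos (2 * θ) = cos θ ^ 2 * (1 - t ^ 2) := by
        rw [cos_two_mul', h]
        ring
      have h3 : sin (2 * θ) = 2 * t * cos θ ^ 2 := by
        rw [sin_two_mul, h]
        ring
      have h4 : (2 * ((m + 1 : ℕ) : ℝ) + 1) * θ = (2 * m + 1) * θ + 2 * θ := by
        push_cast
        ring
      rw [h4, cos_add, sin_add, hc, hs, h2, h3]
      simp only [map_add, map_mul, aeval_X, map_ofNat]
      constructor <;> ring

theorem tan_sq_odd_int_dvd (m : ℕ) (hm : 1 ≤ m) (d : ℤ)
    (hd : Int.gcd d (2 * m + 1) = 1) (hnd : ¬ ((2 * m + 1 : ℤ) ∣ d))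
    (hrat : ¬ Irrational ((Real.tan (2 * d * π / (2 * m + 1))) ^ 2)) :
    ∃ k : ℤ, Odd k ∧ 0 < k ∧ k ∣ (2 * m + 1 : ℤ) ∧
      (Real.tan (2 * d * π / (2 * m + 1))) ^ 2 = (k : ℝ) := by
  obtain ⟨A, B, -, hB, -, hB0, -, hAB⟩ := exists_polynomial_neg_tan_sq m
  have hn : (2 * m + 1 : ℝ) ≠ 0 := by positivity
  set θ : ℝ := 2 * d * π / (2 * m + 1) with hθ
  have hnθ : (2 * m + 1) * θ = d * (2 * π) := by
    rw [hθ]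
    field_simp
  have hsin : sin θ ≠ 0 := by
    intro h
    obtain ⟨j, hj⟩ := sin_eq_zero_iff.mp h
    rw [← hj] at hnθ
    have h1 : ((2 * m + 1) * j : ℝ) = 2 * d := by
      apply mul_right_cancel₀ pi_ne_zero
      linear_combination hnθ
    have h2 : (2 * m + 1 : ℤ) * j = 2 * d := by exact_mod_cast h1
    have hcop : IsCoprime (2 * m + 1 : ℤ) 2 := ⟨1, -m, by ring⟩
    exact hnd (hcop.dvd_of_dvd_mul_left ⟨j, h2.symm⟩)
  have hcos : cos θ ≠ 0 := by
    intro h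
    have h1 : cos ((2 * m + 1 : ℕ) * θ) = 0 := by
      rw [cos_eq_zero_iff] at h ⊢
      obtain ⟨j, hj⟩ := h
      refine ⟨(2 * m + 1) * j + m, ?_⟩
      rw [hj]
      push_cast
      ring
    push_cast at h1
    rw [hnθ, cos_int_mul_two_pi] at h1
    exact one_ne_zero h1
  have htan : tan θ ≠ 0 := by
    rw [tan_eq_sin_div_cos]
    exact div_ne_zero hsin hcos
  have hroot : Polynomial.aeval (-tan θ ^ 2) B = 0 := by
    have h := (hAB θ (tan θ) (tan_mul_cos hcos).symm).2
    have h0 : sin (d * (2 * π)) = 0 := by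
      simpa [mul_assoc] using sin_int_mul_pi (d * 2)
    rw [hnθ, h0] at h
    simpa [hcos, htan] using h.symm
  obtain ⟨q, hq⟩ : ∃ q : ℚ, (q : ℝ) = tan θ ^ 2 := by simpa [Irrational] using hrat
  have hqroot : Polynomial.aeval (-q) B = 0 := by
    rw [← hq] at hroot
    have h := Polynomial.aeval_algebraMap_apply ℝ (-q) B
    rw [eq_ratCast, Rat.cast_neg, hroot] at h
    simpa using h.symm
  obtain ⟨k, hk⟩ := IsIntegrallyClosed.isIntegral_iff.mp (⟨B, hB, hqroot⟩ : IsIntegral ℤ (-q))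
  have hkroot : B.eval k = 0 := by
    rw [← hk, Polynomial.aeval_algebraMap_apply] at hqroot
    simpa using hqroot
  have hdvd : -k ∣ (2 * m + 1 : ℤ) := by
    have h := Polynomial.sub_dvd_eval_sub 0 k B
    rwa [hkroot, hB0, zero_sub, sub_zero] at h
  have hval : tan θ ^ 2 = ((-k : ℤ) : ℝ) := by
    rw [← hq, ← neg_neg q, ← hk]
    simp
  refine ⟨-k, ?_, ?_, hdvd, hval⟩
  · rw [← Int.not_even_iff_odd, even_iff_two_dvd]
    intro h
    have := h.trans hdvd
    omega
  · have h : (0 : ℝ) < ((-k : ℤ) : ℝ) := hval ▸ by positivity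
    exact_mod_cast h
end

section
/- Let r be a rational number with odd denominator n ≥ 3 (in lowest terms) such that n does not divide the numerator. If tan²(2rπ) is rational, then tan²(2rπ) = 3. -/
open Real

/-- If `tan² x` is rational, so is `cos (2x)`. -/
lemma not_irrational_cos_two_mul {x : ℝ} (h : ¬ Irrational (tan x ^ 2)) :
    ¬ Irrational (cos (2 * x)) := by
  rw [Real.cos_two_mul]
  rcases eq_or_ne (cos x) 0 with hx | hx
  · rw [hx]
    exact fun hi => hi ⟨-1, by norm_num⟩
  · obtain ⟨q, hq⟩ := not_not.mp h
    refine fun hi => hi ⟨2 * (1 + q)⁻¹ - 1, ?_⟩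
    rw [← Real.inv_one_add_tan_sq hx, ← hq]
    push_cast
    rfl

/-- Multiplication by `4` preserves odd denominators. -/
lemma den_four_mul {r : ℚ} (hodd : Odd r.den) : (4 * r).den = r.den := by
  have hcop : Nat.Coprime (4 * r.num).natAbs (r.den : ℤ).natAbs := by
    rw [Int.natAbs_mul, Int.natAbs_natCast]
    exact Nat.Coprime.mul_left (Nat.Coprime.pow_left 2 hodd.coprime_two_left) r.reduced
  have h := Rat.den_div_eq_of_coprime (by exact_mod_cast r.den_pos) hcop
  rw [Int.cast_mul, mul_div_assoc, Int.cast_natCast, Rat.num_div_den] at h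
  exact_mod_cast h

lemma tan_sq_eq_three_of_den_eq_three {r : ℚ} (h : r.den = 3) :
    tan (2 * r * π) ^ 2 = 3 := by
  have hr : (r : ℝ) = r.num / 3 := by
    rw [Rat.cast_def, h]
    norm_num
  have hnd : ¬ (3 : ℤ) ∣ r.num := by
    have hcop := r.reduced
    rw [h] at hcop
    have := (Nat.Prime.coprime_iff_not_dvd Nat.prime_three).mp hcop.symm
    omega
  have h3 : √(3 : ℝ) ^ 2 = 3 := Real.sq_sqrt (by norm_num)
  obtain ⟨m, hm | hm⟩ : ∃ m : ℤ, r.num = 3 * m + 1 ∨ r.num = 3 * m - 1 :=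
    ⟨(r.num + 1) / 3, by omega⟩
  · have hx : 2 * (r : ℝ) * π = -(π / 3) + (2 * m + 1 : ℤ) * π := by
      rw [hr, hm]
      push_cast
      ring
    rw [hx, Real.tan_add_int_mul_pi, Real.tan_neg, Real.tan_pi_div_three, neg_sq, h3]
  · have hx : 2 * (r : ℝ) * π = π / 3 + (2 * m - 1 : ℤ) * π := by
      rw [hr, hm]
      push_cast
      ring
    rw [hx, Real.tan_add_int_mul_pi, Real.tan_pi_div_three, h3]

theorem tan_sq_double_eq_three (r : ℚ) (hodd : Odd r.den) (hden : 3 ≤ r.den)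
    (hnd : ¬ ((r.den : ℤ) ∣ r.num))
    (hrat : ¬ Irrational ((Real.tan (2 * r * π)) ^ 2)) :
    (Real.tan (2 * r * π)) ^ 2 = 3 := by
  have hcos : ¬ Irrational (cos ((4 * r : ℚ) * π)) := by
    convert not_irrational_cos_two_mul hrat using 3
    push_cast
    ring
  have hle : (4 * r).den ≤ 3 := not_lt.mp fun h => hcos (irrational_cos_rat_mul_pi h)
  rw [den_four_mul hodd] at hle
  exact tan_sq_eq_three_of_den_eq_three (le_antisymm hle hden)
end
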